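/- Assume (A2) and the normalization ψ(ξ) = 1 for |ξ| = 1. For s ≥ 1 set ν^s(x) = s · ψ^{-1}(1/s)^{-d} · ν(x/ψ^{-1}(1/s)). Then for every x ∈ ℝ^d \ {0}, lim_{s→∞} ν^s(x) = 𝒜(d,α)·|x|^{-d-α}. -/

import Mathlib

open MeasureTheory Filter Real
open scoped RealInnerProductSpace

noncomputable section

/-- Pruitt's concentration function `K(r) = r⁻² ∫_{|z|<r} |z|² ν(|z|) dz`. -/
def K (d : ℕ) (ν : ℝ → ℝ) (r : ℝ) : ℝ :=
  (∫ z in Metric.ball (0 : EuclideanSpace ℝ (Fin d)) r, ‖z‖ ^ 2 * ν ‖z‖) / r ^ 2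

/-- Pruitt's concentration function `h(r) = ∫ (|z|²/r² ∧ 1) ν(|z|) dz`. -/
def hfun (d : ℕ) (ν : ℝ → ℝ) (r : ℝ) : ℝ :=
  ∫ z : EuclideanSpace ℝ (Fin d), min (‖z‖ ^ 2 / r ^ 2) 1 * ν ‖z‖

/-- The characteristic (Lévy–Khintchine) exponent `ψ(ξ) = ∫ (1 - cos⟪ξ,z⟫) ν(|z|) dz`. -/
def ψ (d : ℕ) (ν : ℝ → ℝ) (ξ : EuclideanSpace ℝ (Fin d)) : ℝ :=
  ∫ z : EuclideanSpace ℝ (Fin d), (1 - Real.cos ⟪ξ, z⟫) * ν ‖z‖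

/-- The radial nondecreasing majorant `ψ*(r) = sup_{|z| ≤ r} ψ(z)`. -/
def ψstar (d : ℕ) (ν : ℝ → ℝ) (r : ℝ) : ℝ :=
  sSup {y : ℝ | ∃ z : EuclideanSpace ℝ (Fin d), ‖z‖ ≤ r ∧ ψ d ν z = y}

/-- The generalized inverse `ψ⁻¹(u) = sup {r ≥ 0 : ψ*(r) = u}`. -/
def ψinv (d : ℕ) (ν : ℝ → ℝ) (u : ℝ) : ℝ :=
  sSup {r : ℝ | 0 ≤ r ∧ ψstar d ν r = u}

/-- Characteristic exponent `ψˢ(ξ) = s·ψ(ψ⁻¹(1/s)ξ)` of the rescaled process. -/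
def ψs (d : ℕ) (ν : ℝ → ℝ) (s : ℝ) (ξ : EuclideanSpace ℝ (Fin d)) : ℝ :=
  s * ψ d ν (ψinv d ν (1 / s) • ξ)

/-- Lévy density `νˢ(x) = s·ψ⁻¹(1/s)^{-d}·ν(x/ψ⁻¹(1/s))` of the rescaled process. -/
def νs (d : ℕ) (ν : ℝ → ℝ) (s : ℝ) (x : EuclideanSpace ℝ (Fin d)) : ℝ :=
  s / ψinv d ν (1 / s) ^ d * ν (‖x‖ / ψinv d ν (1 / s))

/-- `ψ^{-1,s}(u) = ψ⁻¹(u/s)/ψ⁻¹(1/s)`. -/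
def ψinvs (d : ℕ) (ν : ℝ → ℝ) (s u : ℝ) : ℝ :=
  ψinv d ν (u / s) / ψinv d ν (1 / s)

/-- The stable constant `𝒜(d,α)`. -/
def Aconst (d : ℕ) (α : ℝ) : ℝ :=
  α * (2 : ℝ) ^ (α - 1) * Real.Gamma (((d : ℝ) + α) / 2) /
    (Real.Gamma (1 - α / 2) * Real.pi ^ ((d : ℝ) / 2))

/-- Heat kernel of the rescaled process, via Fourier inversion. -/
def pts (d : ℕ) (ν : ℝ → ℝ) (s t : ℝ) (x : EuclideanSpace ℝ (Fin d)) : ℝ :=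
  ((2 * Real.pi) ^ d)⁻¹ *
    ∫ ξ : EuclideanSpace ℝ (Fin d), Real.cos ⟪ξ, x⟫ * Real.exp (-(t * ψs d ν s ξ))

/-- Heat kernel of the isotropic α-stable process. -/
def ptα (d : ℕ) (α t : ℝ) (x : EuclideanSpace ℝ (Fin d)) : ℝ :=
  ((2 * Real.pi) ^ d)⁻¹ *
    ∫ ξ : EuclideanSpace ℝ (Fin d), Real.cos ⟪ξ, x⟫ * Real.exp (-(t * ‖ξ‖ ^ α))

/-- Heat kernel of the original process, via Fourier inversion. -/
def pt (d : ℕ) (ν : ℝ → ℝ) (t : ℝ) (x : EuclideanSpace ℝ (Fin d)) : ℝ :=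
  ((2 * Real.pi) ^ d)⁻¹ *
    ∫ ξ : EuclideanSpace ℝ (Fin d), Real.cos ⟪ξ, x⟫ * Real.exp (-(t * ψ d ν ξ))


lemma lintegral_rpow_mul_one_sub_exp_neg_div {a c : ℝ} (ha : a ∈ Set.Ioo (0 : ℝ) 1)
    (hc : 0 ≤ c) :
    ∫⁻ t in Set.Ioi (0 : ℝ), ENNReal.ofReal (t ^ (a - 1) * (1 - exp (-(c / t)))) =
      ENNReal.ofReal (c ^ a * Gamma (1 - a) / a) := by
  have hG : 0 < Gamma (1 - a) := Gamma_pos_of_pos (by linarith [ha.2])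
  have h1 : ∀ t ∈ Set.Ioi (0 : ℝ), ENNReal.ofReal (t ^ (a - 1) * (1 - exp (-(c / t)))) =
      ∫⁻ s in Set.Ioc 0 c, ENNReal.ofReal (t ^ (a - 2) * exp (-(s / t))) := by
    intro t ht
    have ht : 0 < t := ht
    have hcont : Continuous fun s : ℝ => t ^ (a - 2) * exp (-(s / t)) := by fun_prop
    rw [← ofReal_integral_eq_lintegral_ofReal
      (hcont.integrableOn_Icc.mono_set Set.Ioc_subset_Icc_self)
      (Eventually.of_forall fun s => by positivity), ← intervalIntegral.integral_of_le hc]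
    congr 1
    have hd : ∀ s ∈ Set.uIcc 0 c, HasDerivAt (fun s : ℝ => -(t ^ (a - 1)) * exp (-(s / t)))
        (t ^ (a - 2) * exp (-(s / t))) s := by
      intro s _
      have := (((hasDerivAt_id s).div_const t).neg.exp).const_mul (-(t ^ (a - 1)))
      refine this.congr_deriv ?_
      have : t ^ (a - 1) = t ^ (a - 2) * t := by
        rw [← rpow_add_one ht.ne']; congr 1; ring
      simp only [id, Pi.neg_apply]
      rw [this]; field_simp
    rw [intervalIntegral.integral_eq_sub_of_hasDerivAt hd (hcont.intervalIntegrable _ _)]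
    simp; ring
  have h2 : ∀ s ∈ Set.Ioc 0 c, ∫⁻ t in Set.Ioi (0 : ℝ),
      ENNReal.ofReal (t ^ (a - 2) * exp (-(s / t))) =
        ENNReal.ofReal (Gamma (1 - a) * s ^ (a - 1)) := by
    intro s hs
    have hs0 : 0 < s := hs.1
    have key : ∫ t in Set.Ioi (0 : ℝ), t ^ (a - 2) * exp (-(s / t)) =
        Gamma (1 - a) * s ^ (a - 1) := by
      have e1 := integral_rpow_mul_exp_neg_mul_Ioi (a := 1 - a) (r := s) (by linarith [ha.2]) hs0
      have e2 := integral_comp_rpow_Ioi (fun y : ℝ => y ^ (1 - a - 1) * exp (-(s * y)))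
        (p := -1) (by norm_num)
      rw [e1] at e2
      have e3 : (1 / s) ^ (1 - a) * Gamma (1 - a) = Gamma (1 - a) * s ^ (a - 1) := by
        rw [one_div, inv_rpow hs0.le, ← rpow_neg hs0.le, neg_sub, mul_comm]
      rw [← e3, ← e2]
      refine setIntegral_congr_fun measurableSet_Ioi fun t ht => ?_
      have ht : 0 < t := ht
      simp only [abs_neg, abs_one, one_mul, smul_eq_mul]
      rw [← rpow_mul ht.le, rpow_neg_one, ← mul_assoc, ← rpow_add ht, div_eq_mul_inv]
      congr 2; ring
    rw [← key, ofReal_integral_eq_lintegral_ofReal]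
    · refine Integrable.of_integral_ne_zero ?_
      rw [key]; positivity
    · filter_upwards [ae_restrict_mem measurableSet_Ioi] with t ht
      have ht : 0 < t := ht
      positivity
  rw [setLIntegral_congr_fun measurableSet_Ioi h1, lintegral_lintegral_swap (by fun_prop),
    setLIntegral_congr_fun measurableSet_Ioc h2]
  have hi : IntervalIntegrable (fun s : ℝ => Gamma (1 - a) * s ^ (a - 1)) volume 0 c :=
    (intervalIntegral.intervalIntegrable_rpow' (by linarith [ha.1])).const_mul _
  rw [← ofReal_integral_eq_lintegral_ofReal
      ((intervalIntegrable_iff_integrableOn_Ioc_of_le hc).1 hi)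
      (by
        filter_upwards [ae_restrict_mem measurableSet_Ioc] with t ht
        have := ht.1
        positivity), ← intervalIntegral.integral_of_le hc,
    intervalIntegral.integral_const_mul, integral_rpow (Or.inl (by linarith [ha.1]))]
  congr 1
  rw [sub_add_cancel, zero_rpow ha.1.ne']
  ring

lemma integrable_exp_neg_mul_sq_norm_euclidean {d : ℕ} {t : ℝ} (ht : 0 < t) :
    Integrable fun w : EuclideanSpace ℝ (Fin d) => exp (-(t * ‖w‖ ^ 2)) := by
  have := (GaussianFourier.integrable_cexp_neg_mul_sq_norm_add (b := (t : ℂ)) (by simpa using ht) 0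
    (0 : EuclideanSpace ℝ (Fin d))).re
  refine this.congr (Eventually.of_forall fun w => ?_)
  simp only [zero_mul, add_zero]
  rw [show (-(t : ℂ) * (‖w‖ : ℂ) ^ 2) = ((-(t * ‖w‖ ^ 2) : ℝ) : ℂ) by push_cast; ring]
  exact Complex.exp_ofReal_re _

lemma integral_one_sub_cos_mul_exp_neg_mul_sq_norm {d : ℕ} {t : ℝ} (ht : 0 < t)
    (ξ : EuclideanSpace ℝ (Fin d)) :
    ∫ w : EuclideanSpace ℝ (Fin d), (1 - Real.cos ⟪ξ, w⟫) * exp (-(t * ‖w‖ ^ 2)) =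
      (π / t) ^ ((d : ℝ) / 2) * (1 - exp (-(‖ξ‖ ^ 2 / 4 / t))) := by
  have hI := GaussianFourier.integrable_cexp_neg_mul_sq_norm_add (b := (t : ℂ))
    (by simpa using ht) Complex.I ξ
  have hre : ∀ w : EuclideanSpace ℝ (Fin d),
      (Complex.exp (-(t : ℂ) * (‖w‖ : ℂ) ^ 2 + Complex.I * (⟪ξ, w⟫ : ℝ))).re =
        Real.cos ⟪ξ, w⟫ * exp (-(t * ‖w‖ ^ 2)) := by
    intro w
    rw [Complex.exp_re]
    have h1 : (-(t : ℂ) * (‖w‖ : ℂ) ^ 2 + Complex.I * (⟪ξ, w⟫ : ℝ)).re = -(t * ‖w‖ ^ 2) := by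
      simp [← Complex.ofReal_pow]
    have h2 : (-(t : ℂ) * (‖w‖ : ℂ) ^ 2 + Complex.I * (⟪ξ, w⟫ : ℝ)).im = ⟪ξ, w⟫ := by
      simp [← Complex.ofReal_pow]
    rw [h1, h2, mul_comm]
  have hcos : Integrable fun w : EuclideanSpace ℝ (Fin d) =>
      Real.cos ⟪ξ, w⟫ * exp (-(t * ‖w‖ ^ 2)) :=
    hI.re.congr (Eventually.of_forall hre)
  have hval : ∫ w : EuclideanSpace ℝ (Fin d), Real.cos ⟪ξ, w⟫ * exp (-(t * ‖w‖ ^ 2)) =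
      (π / t) ^ ((d : ℝ) / 2) * exp (-(‖ξ‖ ^ 2 / 4 / t)) := by
    have h := congrArg Complex.re (GaussianFourier.integral_cexp_neg_mul_sq_norm_add
      (b := (t : ℂ)) (by simpa using ht) Complex.I ξ)
    have h0 := integral_re hI
    simp only [RCLike.re_to_complex] at h0
    rw [← h0] at h
    simp only [hre] at h
    rw [h, finrank_euclideanSpace_fin, Complex.I_sq,
      show (-1 * (‖ξ‖ : ℂ) ^ 2 / (4 * t)) = ((-(‖ξ‖ ^ 2 / 4 / t) : ℝ) : ℂ) by
        push_cast; field_simp,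
      show ((π : ℂ) / t) ^ ((d : ℂ) / 2) = (((π / t) ^ ((d : ℝ) / 2) : ℝ) : ℂ) by
        rw [Complex.ofReal_cpow (by positivity)]; push_cast; rfl,
      ← Complex.ofReal_exp, ← Complex.ofReal_mul, Complex.ofReal_re]
  have hg : ∫ w : EuclideanSpace ℝ (Fin d), exp (-(t * ‖w‖ ^ 2)) = (π / t) ^ ((d : ℝ) / 2) := by
    have := GaussianFourier.integral_rexp_neg_mul_sq_norm (V := EuclideanSpace ℝ (Fin d)) ht
    simpa [finrank_euclideanSpace_fin] using this
  simp only [sub_mul, one_mul]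
  rw [integral_sub (integrable_exp_neg_mul_sq_norm_euclidean ht) hcos, hg, hval]
  ring

lemma Aconst_pos {d : ℕ} {α : ℝ} (hα : α ∈ Set.Ioo (0 : ℝ) 2) : 0 < Aconst d α := by
  have h0 := hα.1
  have h1 := Gamma_pos_of_pos (show 0 < 1 - α / 2 by linarith [hα.2])
  have h2 := Gamma_pos_of_pos (show 0 < ((d : ℝ) + α) / 2 by positivity)
  unfold Aconst
  positivity

/-- The characteristic exponent of the isotropic stable Lévy density `|w| ^ (-d - α)`. -/
lemma integral_one_sub_cos_mul_norm_rpow {d : ℕ} (hd : 1 ≤ d) {α : ℝ}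
    (hα : α ∈ Set.Ioo (0 : ℝ) 2) (ξ : EuclideanSpace ℝ (Fin d)) :
    ∫ w : EuclideanSpace ℝ (Fin d), (1 - Real.cos ⟪ξ, w⟫) * ‖w‖ ^ (-(d : ℝ) - α) =
      ‖ξ‖ ^ α / Aconst d α := by
  have : Nonempty (Fin d) := ⟨⟨0, hd⟩⟩
  have h0 := hα.1
  set q : ℝ := (d + α) / 2 with hq
  have hq0 : 0 < q := by positivity
  have hGq := Gamma_pos_of_pos hq0
  have hG1 := Gamma_pos_of_pos (show 0 < 1 - α / 2 by linarith [hα.2])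
  have hcos : ∀ w : EuclideanSpace ℝ (Fin d), 0 ≤ 1 - Real.cos ⟪ξ, w⟫ := fun w =>
    sub_nonneg.2 (cos_le_one _)
  have h1 : ∀ᵐ w : EuclideanSpace ℝ (Fin d),
      ENNReal.ofReal ((1 - Real.cos ⟪ξ, w⟫) * ‖w‖ ^ (-(d : ℝ) - α)) =
      ∫⁻ t in Set.Ioi (0 : ℝ), ENNReal.ofReal
        ((Gamma q)⁻¹ * t ^ (q - 1) * ((1 - Real.cos ⟪ξ, w⟫) * exp (-(t * ‖w‖ ^ 2)))) := by
    filter_upwards [compl_mem_ae_iff.2 (measure_singleton (0 : EuclideanSpace ℝ (Fin d)))]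
      with w hw
    have hw : 0 < ‖w‖ := norm_pos_iff.2 hw
    have e1 := integral_rpow_mul_exp_neg_mul_Ioi (a := q) (r := ‖w‖ ^ 2) hq0 (by positivity)
    have e4 : (1 / ‖w‖ ^ 2) ^ q = ‖w‖ ^ (-(d : ℝ) - α) := by
      rw [one_div, inv_rpow (by positivity), ← rpow_natCast, ← rpow_mul hw.le, ← rpow_neg hw.le]
      congr 1; rw [hq]; push_cast; ring
    have e2 : Integrable (fun t : ℝ => t ^ (q - 1) * exp (-(‖w‖ ^ 2 * t)))
        (volume.restrict (Set.Ioi 0)) := by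
      refine Integrable.of_integral_ne_zero ?_
      rw [e1]; positivity
    have e3 : (1 - Real.cos ⟪ξ, w⟫) * ‖w‖ ^ (-(d : ℝ) - α) = ∫ t in Set.Ioi (0 : ℝ),
        ((Gamma q)⁻¹ * (1 - Real.cos ⟪ξ, w⟫)) * (t ^ (q - 1) * exp (-(‖w‖ ^ 2 * t))) := by
      rw [integral_const_mul, e1, e4]; field_simp
    rw [e3, ofReal_integral_eq_lintegral_ofReal (e2.const_mul _)]
    · refine lintegral_congr fun t => ?_
      congr 1
      rw [mul_comm t]; ring
    · filter_upwards [ae_restrict_mem measurableSet_Ioi] with t ht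
      have ht : 0 < t := ht
      have := hcos w
      positivity
  have h2 : ∀ t ∈ Set.Ioi (0 : ℝ), ∫⁻ w : EuclideanSpace ℝ (Fin d), ENNReal.ofReal
        ((Gamma q)⁻¹ * t ^ (q - 1) * ((1 - Real.cos ⟪ξ, w⟫) * exp (-(t * ‖w‖ ^ 2)))) =
      ENNReal.ofReal ((Gamma q)⁻¹ * π ^ ((d : ℝ) / 2)) *
        ENNReal.ofReal (t ^ (α / 2 - 1) * (1 - exp (-(‖ξ‖ ^ 2 / 4 / t)))) := by
    intro t ht
    have ht : 0 < t := ht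
    rw [← ofReal_integral_eq_lintegral_ofReal, integral_const_mul,
      integral_one_sub_cos_mul_exp_neg_mul_sq_norm ht, ← ENNReal.ofReal_mul (by positivity)]
    · congr 1
      rw [div_rpow pi_pos.le ht.le]
      have : t ^ (q - 1) = t ^ (α / 2 - 1) * t ^ ((d : ℝ) / 2) := by
        rw [← rpow_add ht]; congr 1; rw [hq]; ring
      rw [this]; field_simp
    · refine Integrable.const_mul ?_ _
      refine ((integrable_exp_neg_mul_sq_norm_euclidean ht).const_mul 2).mono' (by fun_prop)
        (Eventually.of_forall fun w => ?_)
      rw [norm_of_nonneg (mul_nonneg (hcos w) (exp_pos _).le)]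
      have := neg_one_le_cos ⟪ξ, w⟫
      gcongr; linarith
    · refine Eventually.of_forall fun w => ?_
      have := hcos w
      positivity
  rw [integral_eq_lintegral_of_nonneg_ae
    (Eventually.of_forall fun w => mul_nonneg (hcos w) (by positivity))
    (Measurable.aestronglyMeasurable (by fun_prop)), lintegral_congr_ae h1,
    lintegral_lintegral_swap (by fun_prop), setLIntegral_congr_fun measurableSet_Ioi h2,
    lintegral_const_mul _ (by fun_prop),
    lintegral_rpow_mul_one_sub_exp_neg_div ⟨by positivity, by linarith [hα.2]⟩ (by positivity),
    ← ENNReal.ofReal_mul (by positivity), ENNReal.toReal_ofReal (by positivity)]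
  have e : (‖ξ‖ ^ 2 / 4) ^ (α / 2) = ‖ξ‖ ^ α / 2 ^ α := by
    rw [show ‖ξ‖ ^ 2 / 4 = (‖ξ‖ / 2) ^ (2 : ℝ) by rw [rpow_two]; ring, ← rpow_mul (by positivity),
      div_rpow (by positivity) (by positivity)]
    congr 2 <;> ring
  rw [e, Aconst, rpow_sub_one two_ne_zero, ← hq]
  field_simp

lemma integrable_min_sq_mul_norm_rpow {d : ℕ} (hd : 1 ≤ d) {p : ℝ} (h1 : (d : ℝ) < p)
    (h2 : p < d + 2) :
    Integrable fun w : EuclideanSpace ℝ (Fin d) => min (‖w‖ ^ 2) 1 * ‖w‖ ^ (-p) := by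
  have : Nonempty (Fin d) := ⟨⟨0, hd⟩⟩
  have hd' : ((d - 1 : ℕ) : ℝ) = d - 1 := by push_cast [Nat.cast_sub hd]; ring
  rw [integrable_fun_norm_addHaar (volume : Measure (EuclideanSpace ℝ (Fin d)))
    (f := fun y : ℝ => min (y ^ 2) 1 * y ^ (-p)), finrank_euclideanSpace_fin,
    ← Set.Ioc_union_Ioi_eq_Ioi zero_le_one, integrableOn_union]
  constructor
  · have h := (intervalIntegrable_iff_integrableOn_Ioc_of_le zero_le_one).1
      (intervalIntegral.intervalIntegrable_rpow' (a := 0) (b := 1)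
        (r := d - 1 + 2 - p) (by linarith))
    refine h.congr_fun (fun y hy => ?_) measurableSet_Ioc
    have hy0 : 0 < y := hy.1
    simp only [smul_eq_mul]
    rw [min_eq_left (pow_le_one₀ hy0.le hy.2), ← rpow_natCast, ← rpow_natCast y 2, hd',
      ← rpow_add hy0, ← rpow_add hy0]
    congr 1; push_cast; ring
  · have h := integrableOn_Ioi_rpow_of_lt (a := d - 1 - p) (c := 1) (by linarith) zero_lt_one
    refine h.congr_fun (fun y hy => ?_) measurableSet_Ioi
    have hy1 : 1 < y := hy
    have hy0 : 0 < y := by linarith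
    simp only [smul_eq_mul]
    rw [min_eq_right (one_le_pow₀ hy1.le), one_mul, ← rpow_natCast, hd', ← rpow_add hy0]
    congr 1

lemma one_sub_cos_inner_le {d : ℕ} {b : ℝ} (hb : 1 ≤ b) {ξ : EuclideanSpace ℝ (Fin d)}
    (hξ : ‖ξ‖ ≤ b) (w : EuclideanSpace ℝ (Fin d)) :
    1 - Real.cos ⟪ξ, w⟫ ≤ 2 * b ^ 2 * min (‖w‖ ^ 2) 1 := by
  have hb2 : 1 ≤ b ^ 2 := one_le_pow₀ hb
  rcases min_choice (‖w‖ ^ 2) (1 : ℝ) with h | h <;> rw [h]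
  · have h1 := one_sub_sq_div_two_le_cos (x := ⟪ξ, w⟫)
    have h2 : |⟪ξ, w⟫| ≤ b * ‖w‖ :=
      (abs_real_inner_le_norm ξ w).trans (by gcongr)
    have h3 : ⟪ξ, w⟫ ^ 2 ≤ (b * ‖w‖) ^ 2 := sq_le_sq' (abs_le.1 h2).1 (abs_le.1 h2).2
    have : 0 ≤ (b * ‖w‖) ^ 2 := by positivity
    rw [mul_pow] at *
    linarith
  · have := neg_one_le_cos ⟪ξ, w⟫
    linarith

lemma ae_norm_pos {d : ℕ} (hd : 1 ≤ d) : ∀ᵐ w : EuclideanSpace ℝ (Fin d), 0 < ‖w‖ := by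
  have : Nonempty (Fin d) := ⟨⟨0, hd⟩⟩
  filter_upwards [compl_mem_ae_iff.2 (measure_singleton (0 : EuclideanSpace ℝ (Fin d)))]
    with w hw
  exact norm_pos_iff.2 hw

lemma aestronglyMeasurable_antitone_comp_norm {d : ℕ} (hd : 1 ≤ d) {ν : ℝ → ℝ}
    (hν_mono : ∀ r₁ r₂ : ℝ, 0 < r₁ → r₁ ≤ r₂ → ν r₂ ≤ ν r₁) {R : ℝ} (hR : 0 < R) :
    AEStronglyMeasurable (fun w : EuclideanSpace ℝ (Fin d) => ν (R * ‖w‖)) := by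
  let g : ℝ → EReal := fun r => if r ≤ 0 then ⊤ else (ν r : EReal)
  have hg : Antitone g := by
    intro a b hab
    by_cases ha : a ≤ 0
    · simp [g, ha]
    · have hb : ¬ b ≤ 0 := by linarith
      simp only [g, ha, hb, if_false]
      exact_mod_cast hν_mono a b (by linarith) hab
  have hm : Measurable fun w : EuclideanSpace ℝ (Fin d) => (g (R * ‖w‖)).toReal :=
    (hg.measurable.comp (by fun_prop)).ereal_toReal
  refine hm.aestronglyMeasurable.congr ?_
  filter_upwards [ae_norm_pos hd] with w hw
  have : ¬ R * ‖w‖ ≤ 0 := by have := mul_pos hR hw; linarith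
  simp [g, this]

/-- Potter bounds for a nonincreasing function which is regularly varying of index `-q`. -/
lemma exists_potter_bounds {ν : ℝ → ℝ} {q δ : ℝ} (hδ : 0 < δ) (hδq : δ < q)
    (hν_pos : ∀ r : ℝ, 0 < r → 0 < ν r)
    (hν_mono : ∀ r₁ r₂ : ℝ, 0 < r₁ → r₁ ≤ r₂ → ν r₂ ≤ ν r₁)
    (h2 : Tendsto (fun r : ℝ => ν (2 * r) / ν r) atTop (nhds ((2 : ℝ) ^ (-q)))) :
    ∃ C R₀ : ℝ, 0 < C ∧ 1 ≤ R₀ ∧ ∀ R, R₀ ≤ R → ∀ t, 1 ≤ t →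
      ν (t * R) ≤ C * t ^ (-(q - δ)) * ν R ∧ ν R ≤ C * t ^ (q + δ) * ν (t * R) := by
  have l1 : (2 : ℝ) ^ (-q) < 2 ^ (-(q - δ)) := rpow_lt_rpow_of_exponent_lt one_lt_two (by linarith)
  have l2 : (2 : ℝ) ^ (-(q + δ)) < 2 ^ (-q) := rpow_lt_rpow_of_exponent_lt one_lt_two (by linarith)
  obtain ⟨R₁, hR₁⟩ := eventually_atTop.1 ((h2.eventually_lt_const l1).and
    (h2.eventually_const_lt l2))
  refine ⟨2 ^ (q + δ), max R₁ 1, by positivity, le_max_right _ _, fun R hR t ht => ?_⟩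
  have hR1 : 1 ≤ R := (le_max_right _ _).trans hR
  have hR0 : R₁ ≤ R := (le_max_left _ _).trans hR
  have step : ∀ k : ℕ, ν (2 ^ k * R) ≤ ((2 : ℝ) ^ k) ^ (-(q - δ)) * ν R ∧
      ν R ≤ ((2 : ℝ) ^ k) ^ (q + δ) * ν (2 ^ k * R) := by
    intro k
    induction k with
    | zero => simp
    | succ k ih =>
      have hk : (1 : ℝ) ≤ 2 ^ k := one_le_pow₀ one_le_two
      have hkR : R ≤ 2 ^ k * R := le_mul_of_one_le_left (by linarith) hk
      have hp := hν_pos (2 ^ k * R) (by linarith)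
      obtain ⟨a, b⟩ := hR₁ (2 ^ k * R) (hR0.trans hkR)
      rw [div_lt_iff₀ hp] at a
      rw [lt_div_iff₀ hp] at b
      have e : (2 : ℝ) ^ (k + 1) * R = 2 * (2 ^ k * R) := by ring
      rw [e, pow_succ', mul_rpow (by norm_num) (by positivity),
        mul_rpow (by norm_num) (by positivity)]
      constructor
      · calc _ ≤ (2 : ℝ) ^ (-(q - δ)) * ν (2 ^ k * R) := a.le
          _ ≤ 2 ^ (-(q - δ)) * (((2 : ℝ) ^ k) ^ (-(q - δ)) * ν R) := by gcongr; exact ih.1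
          _ = _ := by ring
      · have b' : ν (2 ^ k * R) ≤ 2 ^ (q + δ) * ν (2 * (2 ^ k * R)) := by
          have h3 : (2 : ℝ) ^ (q + δ) * 2 ^ (-(q + δ)) = 1 := by
            rw [← rpow_add two_pos]; simp
          calc ν (2 ^ k * R) = 2 ^ (q + δ) * (2 ^ (-(q + δ)) * ν (2 ^ k * R)) := by
                rw [← mul_assoc, h3, one_mul]
            _ ≤ _ := by gcongr
        calc _ ≤ ((2 : ℝ) ^ k) ^ (q + δ) * ν (2 ^ k * R) := ih.2
          _ ≤ ((2 : ℝ) ^ k) ^ (q + δ) * (2 ^ (q + δ) * ν (2 * (2 ^ k * R))) := by gcongr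
          _ = _ := by ring
  obtain ⟨k, hk1, hk2⟩ := exists_nat_pow_near ht one_lt_two
  have hk0 : (0 : ℝ) < 2 ^ k := by positivity
  have ht0 : 0 < t := by linarith
  have hνR := hν_pos R (by linarith)
  have hνt := hν_pos (t * R) (by positivity)
  constructor
  · calc ν (t * R) ≤ ν (2 ^ k * R) := hν_mono _ _ (by positivity) (by gcongr)
      _ ≤ ((2 : ℝ) ^ k) ^ (-(q - δ)) * ν R := (step k).1
      _ ≤ (t / 2) ^ (-(q - δ)) * ν R := by
        gcongr ?_ * _
        refine rpow_le_rpow_of_nonpos (by positivity) ?_ (by linarith)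
        rw [pow_succ] at hk2; linarith
      _ = 2 ^ (q - δ) * t ^ (-(q - δ)) * ν R := by
        rw [div_rpow ht0.le two_pos.le, rpow_neg two_pos.le, div_inv_eq_mul]; ring
      _ ≤ _ := by
        gcongr
        · exact one_le_two
        · linarith
  · calc ν R ≤ ((2 : ℝ) ^ (k + 1)) ^ (q + δ) * ν (2 ^ (k + 1) * R) := (step (k + 1)).2
      _ ≤ ((2 : ℝ) * t) ^ (q + δ) * ν (t * R) := by
        have : ν (2 ^ (k + 1) * R) ≤ ν (t * R) := hν_mono _ _ (by positivity) (by gcongr)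
        gcongr
        · exact (hν_pos _ (by positivity)).le
        · linarith
        · rw [pow_succ']; gcongr
      _ = _ := by rw [mul_rpow two_pos.le ht0.le]

lemma continuous_ψ {d : ℕ} (hd : 1 ≤ d) {ν : ℝ → ℝ} (hν_pos : ∀ r : ℝ, 0 < r → 0 < ν r)
    (hν_mono : ∀ r₁ r₂ : ℝ, 0 < r₁ → r₁ ≤ r₂ → ν r₂ ≤ ν r₁)
    (hint : Integrable (fun z : EuclideanSpace ℝ (Fin d) => min (‖z‖ ^ 2) 1 * ν ‖z‖)) :
    Continuous (ψ d ν) := by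
  have hmeas := aestronglyMeasurable_antitone_comp_norm hd hν_mono one_pos
  simp only [one_mul] at hmeas
  refine continuous_iff_continuousAt.2 fun ξ₀ => ?_
  refine continuousAt_of_dominated
    (bound := fun z => 2 * (‖ξ₀‖ + 1) ^ 2 * (min (‖z‖ ^ 2) 1 * ν ‖z‖)) ?_ ?_
    (hint.const_mul _) ?_
  · exact Eventually.of_forall fun ξ =>
      (Measurable.aestronglyMeasurable (by fun_prop)).mul hmeas
  · filter_upwards [Metric.ball_mem_nhds ξ₀ one_pos] with ξ hξ
    filter_upwards [ae_norm_pos hd] with z hz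
    have hν := hν_pos _ hz
    have hξ' : ‖ξ‖ ≤ ‖ξ₀‖ + 1 := by
      have := norm_le_norm_add_norm_sub ξ₀ ξ
      rw [Metric.mem_ball, dist_eq_norm, ← norm_neg, neg_sub] at hξ
      linarith
    rw [norm_of_nonneg (mul_nonneg (sub_nonneg.2 (cos_le_one _)) hν.le), ← mul_assoc]
    gcongr
    exact one_sub_cos_inner_le (by linarith [norm_nonneg ξ₀]) hξ' z
  · refine Eventually.of_forall fun z => ?_
    fun_prop

lemma ψ_inv_smul {d : ℕ} (ν : ℝ → ℝ) {R : ℝ} (hR : 0 < R) (ξ : EuclideanSpace ℝ (Fin d)) :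
    ψ d ν (R⁻¹ • ξ) =
      R ^ d * ∫ w : EuclideanSpace ℝ (Fin d), (1 - Real.cos ⟪ξ, w⟫) * ν (R * ‖w‖) := by
  have h := Measure.integral_comp_smul (volume : Measure (EuclideanSpace ℝ (Fin d)))
    (fun z => (1 - Real.cos ⟪R⁻¹ • ξ, z⟫) * ν ‖z‖) R
  rw [finrank_euclideanSpace_fin, abs_of_nonneg (by positivity), smul_eq_mul] at h
  rw [ψ, eq_comm, ← eq_inv_mul_iff_mul_eq₀ (by positivity), ← h]
  congr 1; ext w
  rw [norm_smul, norm_of_nonneg hR.le, real_inner_smul_left, real_inner_smul_right,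
    inv_mul_cancel_left₀ hR.ne']

/-- Convergence of the rescaled Lévy densities, weighted by `|w|² ∧ 1`, in `L¹`. -/
lemma tendsto_integral_min_sq_mul_abs_sub {d : ℕ} (hd : 1 ≤ d) {ν : ℝ → ℝ}
    (hν_pos : ∀ r : ℝ, 0 < r → 0 < ν r)
    (hν_mono : ∀ r₁ r₂ : ℝ, 0 < r₁ → r₁ ≤ r₂ → ν r₂ ≤ ν r₁)
    (hint : Integrable (fun z : EuclideanSpace ℝ (Fin d) => min (‖z‖ ^ 2) 1 * ν ‖z‖))
    {α : ℝ} (hα : α ∈ Set.Ioo (0 : ℝ) 2)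
    (hA2 : ∀ lam : ℝ, 0 < lam →
      Tendsto (fun r : ℝ => ν (lam * r) / ν r) atTop (nhds (lam ^ (-(d : ℝ) - α)))) :
    Tendsto (fun R : ℝ => ∫ w : EuclideanSpace ℝ (Fin d),
      min (‖w‖ ^ 2) 1 * |ν (R * ‖w‖) / ν R - ‖w‖ ^ (-(d : ℝ) - α)|) atTop (nhds 0) := by
  obtain ⟨hα0, hα2⟩ := hα
  obtain ⟨δ, hδ0, hδα, hδ2⟩ : ∃ δ : ℝ, 0 < δ ∧ δ < α ∧ δ < 2 - α := by
    obtain ⟨δ, h1, h2⟩ := exists_between (lt_min hα0 (sub_pos.2 hα2))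
    exact ⟨δ, h1, h2.trans_le (min_le_left _ _), h2.trans_le (min_le_right _ _)⟩
  set q : ℝ := d + α with hq
  have hdq : -(d : ℝ) - α = -q := by rw [hq]; ring
  simp only [hdq] at hA2 ⊢
  have hd1 : (1 : ℝ) ≤ d := by exact_mod_cast hd
  obtain ⟨C, R₀, hC, hR₀, hpot⟩ := exists_potter_bounds hδ0 (show δ < q by linarith)
    hν_pos hν_mono (hA2 2 two_pos)
  have hR₀' : 0 < R₀ := by linarith
  let m : EuclideanSpace ℝ (Fin d) → ℝ := fun w => min (‖w‖ ^ 2) 1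
  have hm0 : ∀ w, 0 ≤ m w := fun w => le_min (by positivity) zero_le_one
  have hmm : Measurable m := by fun_prop
  let S : ℝ → Set (EuclideanSpace ℝ (Fin d)) := fun R => {w | R₀ ≤ R * ‖w‖}
  have hS : ∀ R, MeasurableSet (S R) := fun R => measurableSet_le (by fun_prop) (by fun_prop)
  let G : ℝ → EuclideanSpace ℝ (Fin d) → ℝ := fun R =>
    (S R).indicator fun w => m w * (ν (R * ‖w‖) / ν R)
  let B : EuclideanSpace ℝ (Fin d) → ℝ := fun w =>
    C * (m w * ‖w‖ ^ (-(q + δ)) + m w * ‖w‖ ^ (-(q - δ)))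
  have hB : Integrable B :=
    ((integrable_min_sq_mul_norm_rpow hd (by linarith) (by linarith)).add
      (integrable_min_sq_mul_norm_rpow hd (by linarith) (by linarith))).const_mul C
  have hL : Integrable fun w => m w * ‖w‖ ^ (-q) :=
    integrable_min_sq_mul_norm_rpow hd (by linarith) (by linarith)
  have hνm : ∀ R : ℝ, 0 < R → AEStronglyMeasurable
      (fun w : EuclideanSpace ℝ (Fin d) => m w * (ν (R * ‖w‖) / ν R)) := fun R hR =>
    hmm.aestronglyMeasurable.mul (by
      simpa only [div_eq_mul_inv] using
        (aestronglyMeasurable_antitone_comp_norm hd hν_mono hR).mul_const (ν R)⁻¹)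
  have hGB : ∀ R, R₀ ≤ R → ∀ w : EuclideanSpace ℝ (Fin d), 0 < ‖w‖ → ‖G R w‖ ≤ B w := by
    intro R hR w hw
    have hR0 : 0 < R := hR₀'.trans_le hR
    have hνR := hν_pos R hR0
    have hb1 : 0 ≤ m w * ‖w‖ ^ (-(q + δ)) := mul_nonneg (hm0 w) (by positivity)
    have hb2 : 0 ≤ m w * ‖w‖ ^ (-(q - δ)) := mul_nonneg (hm0 w) (by positivity)
    by_cases hwS : w ∈ S R
    · have hRw : R₀ ≤ R * ‖w‖ := hwS
      have hνw := hν_pos (R * ‖w‖) (by positivity)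
      simp only [G, Set.indicator_of_mem hwS]
      rw [norm_of_nonneg (mul_nonneg (hm0 w) (by positivity))]
      rcases le_total 1 ‖w‖ with h | h
      · have h1 := (hpot R hR ‖w‖ h).1
        rw [mul_comm ‖w‖, ← div_le_iff₀ hνR] at h1
        calc m w * (ν (R * ‖w‖) / ν R) ≤ m w * (C * ‖w‖ ^ (-(q - δ))) :=
              mul_le_mul_of_nonneg_left h1 (hm0 w)
          _ = C * (0 + m w * ‖w‖ ^ (-(q - δ))) := by ring
          _ ≤ B w := by simp only [B]; gcongr
      · have h1 := (hpot (R * ‖w‖) hRw ‖w‖⁻¹ (one_le_inv_iff₀.2 ⟨hw, h⟩)).2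
        rw [mul_comm R, inv_mul_cancel_left₀ hw.ne', ← div_le_iff₀ hνR, inv_rpow hw.le,
          ← rpow_neg hw.le, mul_comm ‖w‖] at h1
        calc m w * (ν (R * ‖w‖) / ν R) ≤ m w * (C * ‖w‖ ^ (-(q + δ))) :=
              mul_le_mul_of_nonneg_left h1 (hm0 w)
          _ = C * (m w * ‖w‖ ^ (-(q + δ)) + 0) := by ring
          _ ≤ B w := by simp only [B]; gcongr
    · simp only [G, Set.indicator_of_notMem hwS, norm_zero]
      exact mul_nonneg hC.le (add_nonneg hb1 hb2)
  have hGm : ∀ R, R₀ ≤ R → AEStronglyMeasurable (G R) := fun R hR =>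
    (hνm R (by linarith)).indicator (hS R)
  have hGi : ∀ R, R₀ ≤ R → Integrable (G R) := fun R hR =>
    hB.mono' (hGm R hR) (by filter_upwards [ae_norm_pos hd] with w hw using hGB R hR w hw)
  have hfar : Tendsto (fun R => ∫ w, |G R w - m w * ‖w‖ ^ (-q)|) atTop (nhds 0) := by
    have hz : (0 : ℝ) = ∫ _ : EuclideanSpace ℝ (Fin d), (0 : ℝ) := by simp
    rw [hz]
    refine tendsto_integral_filter_of_dominated_convergence
      (bound := fun w => B w + m w * ‖w‖ ^ (-q)) ?_ ?_ (hB.add hL) ?_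
    · filter_upwards [eventually_ge_atTop R₀] with R hR
      exact ((hGi R hR).sub hL).abs.aestronglyMeasurable
    · filter_upwards [eventually_ge_atTop R₀] with R hR
      filter_upwards [ae_norm_pos hd] with w hw
      rw [norm_eq_abs, abs_abs]
      refine (abs_sub _ _).trans (add_le_add (hGB R hR w hw) ?_)
      rw [abs_of_nonneg (mul_nonneg (hm0 w) (by positivity))]
    · filter_upwards [ae_norm_pos hd] with w hw
      have h1 : Tendsto (fun R => m w * (ν (R * ‖w‖) / ν R)) atTop
          (nhds (m w * ‖w‖ ^ (-q))) := by
        simpa only [mul_comm ‖w‖] using (hA2 ‖w‖ hw).const_mul (m w)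
      have h2 : Tendsto (fun R => G R w) atTop (nhds (m w * ‖w‖ ^ (-q))) := by
        refine h1.congr' ?_
        filter_upwards [eventually_ge_atTop (R₀ / ‖w‖)] with R hR
        have : w ∈ S R := (div_le_iff₀ hw).1 hR
        simp only [G, Set.indicator_of_mem this]
      simpa using (h2.sub_const (m w * ‖w‖ ^ (-q))).abs
  let Φ : EuclideanSpace ℝ (Fin d) → ℝ := fun z => min (‖z‖ ^ 2) 1 * ν ‖z‖
  have hΦR : ∀ R : ℝ, 0 < R → Integrable (fun w => Φ (R • w)) := fun R hR =>
    hint.comp_smul hR.ne'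
  let κ : ℝ → ℝ := fun R => R₀ ^ 2 / R ^ 2 / ν R
  have hpt : ∀ R, R₀ ≤ R → ∀ w : EuclideanSpace ℝ (Fin d), 0 < ‖w‖ →
      m w * |ν (R * ‖w‖) / ν R - ‖w‖ ^ (-q)| ≤
        |G R w - m w * ‖w‖ ^ (-q)| + κ R * Φ (R • w) := by
    intro R hR w hw
    have hR0 : 0 < R := hR₀'.trans_le hR
    have hνR := hν_pos R hR0
    have hνw := hν_pos (R * ‖w‖) (by positivity)
    have hnorm : ‖R • w‖ = R * ‖w‖ := by rw [norm_smul, norm_of_nonneg hR0.le]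
    by_cases hwS : w ∈ S R
    · simp only [G, Set.indicator_of_mem hwS]
      rw [← mul_sub, abs_mul, abs_of_nonneg (hm0 w), le_add_iff_nonneg_right]
      simp only [Φ, κ, hnorm]
      have : 0 ≤ min ((R * ‖w‖) ^ 2) 1 := le_min (by positivity) zero_le_one
      positivity
    · have hRw : R * ‖w‖ < R₀ := not_le.1 hwS
      simp only [G, Set.indicator_of_notMem hwS, zero_sub, abs_neg]
      rw [abs_of_nonneg (mul_nonneg (hm0 w) (by positivity))]
      have hmw : m w ≤ R₀ ^ 2 / R ^ 2 * min ((R * ‖w‖) ^ 2) 1 := by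
        rw [mul_min_of_nonneg _ _ (by positivity)]
        refine le_min ((min_le_left _ _).trans ?_) ((min_le_left _ _).trans ?_)
        · rw [mul_pow, div_mul_eq_mul_div, le_div_iff₀ (by positivity)]
          have : 1 ≤ R₀ ^ 2 := one_le_pow₀ hR₀
          have h0 : 0 ≤ R ^ 2 * ‖w‖ ^ 2 := by positivity
          nlinarith
        · rw [mul_one, ← div_pow]
          gcongr
          rw [le_div_iff₀ hR0]; linarith
      calc m w * |ν (R * ‖w‖) / ν R - ‖w‖ ^ (-q)|
          ≤ m w * (ν (R * ‖w‖) / ν R + ‖w‖ ^ (-q)) := by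
            refine mul_le_mul_of_nonneg_left ?_ (hm0 w)
            refine (abs_sub _ _).trans (le_of_eq ?_)
            rw [abs_of_nonneg (by positivity), abs_of_nonneg (by positivity)]
        _ = m w * ‖w‖ ^ (-q) + m w * (ν (R * ‖w‖) / ν R) := by ring
        _ ≤ m w * ‖w‖ ^ (-q) + R₀ ^ 2 / R ^ 2 * min ((R * ‖w‖) ^ 2) 1 *
              (ν (R * ‖w‖) / ν R) := by gcongr
        _ = _ := by simp only [Φ, κ, hnorm]; ring
  have hnear : Tendsto (fun R => ∫ w, κ R * Φ (R • w)) atTop (nhds 0) := by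
    have hΦ0 : 0 ≤ ∫ z, Φ z := by
      refine integral_nonneg_of_ae ?_
      filter_upwards [ae_norm_pos hd] with z hz
      exact mul_nonneg (hm0 z) (hν_pos _ hz).le
    let D : ℝ := R₀ ^ 2 * (C * R₀ ^ (-(q + δ)) / ν R₀) * ∫ z, Φ z
    have hlim : Tendsto (fun R : ℝ => D * R ^ (-(2 - α - δ))) atTop (nhds 0) := by
      simpa using (tendsto_rpow_neg_atTop (show 0 < 2 - α - δ by linarith)).const_mul D
    refine tendsto_of_tendsto_of_tendsto_of_le_of_le' tendsto_const_nhds hlim ?_ ?_ <;>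
      filter_upwards [eventually_ge_atTop R₀] with R hR
    all_goals
      have hR0 : 0 < R := hR₀'.trans_le hR
      have hνR := hν_pos R hR0
      rw [integral_const_mul, Measure.integral_comp_smul, finrank_euclideanSpace_fin,
        abs_of_nonneg (by positivity), smul_eq_mul]
    · positivity
    · have hνR₀ := hν_pos R₀ hR₀'
      have h1 := (hpot R₀ le_rfl (R / R₀) ((one_le_div hR₀').2 hR)).2
      rw [div_mul_cancel₀ _ hR₀'.ne', div_rpow hR0.le hR₀'.le] at h1
      have h2 : 1 / ν R ≤ C * R₀ ^ (-(q + δ)) / ν R₀ * R ^ (q + δ) := by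
        rw [div_le_iff₀ hνR, rpow_neg hR₀'.le]
        calc (1 : ℝ) = ν R₀ / ν R₀ := (div_self hνR₀.ne').symm
          _ ≤ C * (R ^ (q + δ) / R₀ ^ (q + δ)) * ν R / ν R₀ := by gcongr
          _ = _ := by field_simp
      have h3 : R ^ (-(2 - α - δ)) = R ^ (q + δ) / R ^ 2 / R ^ d := by
        rw [← rpow_natCast, ← rpow_natCast R d, ← rpow_sub hR0, ← rpow_sub hR0, hq]
        congr 1; push_cast; ring
      calc κ R * ((R ^ d)⁻¹ * ∫ z, Φ z)
          = R₀ ^ 2 / R ^ 2 * (1 / ν R) * ((R ^ d)⁻¹ * ∫ z, Φ z) := by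
            simp only [κ]; ring
        _ ≤ R₀ ^ 2 / R ^ 2 * (C * R₀ ^ (-(q + δ)) / ν R₀ * R ^ (q + δ)) *
              ((R ^ d)⁻¹ * ∫ z, Φ z) := by gcongr
        _ = D * R ^ (-(2 - α - δ)) := by rw [h3]; simp only [D]; ring
  have hsum := hfar.add hnear
  rw [add_zero] at hsum
  refine tendsto_of_tendsto_of_tendsto_of_le_of_le' tendsto_const_nhds hsum
    (Eventually.of_forall fun R => integral_nonneg fun w => mul_nonneg (hm0 w) (abs_nonneg _)) ?_
  filter_upwards [eventually_ge_atTop R₀] with R hR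
  have hi1 := ((hGi R hR).sub hL).abs
  have hi2 := (hΦR R (by linarith)).const_mul (κ R)
  simp only [Pi.sub_apply] at hi1
  rw [← integral_add hi1 hi2]
  refine integral_mono_of_nonneg
    (Eventually.of_forall fun w => mul_nonneg (hm0 w) (abs_nonneg _)) (hi1.add hi2) ?_
  filter_upwards [ae_norm_pos hd] with w hw using hpt R hR w hw

/-- Near the origin, `ψ` is uniformly close to the stable exponent after rescaling. -/
lemma eventually_abs_ψ_inv_smul_div_sub_le {d : ℕ} (hd : 1 ≤ d) {ν : ℝ → ℝ}
    (hν_pos : ∀ r : ℝ, 0 < r → 0 < ν r)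
    (hν_mono : ∀ r₁ r₂ : ℝ, 0 < r₁ → r₁ ≤ r₂ → ν r₂ ≤ ν r₁)
    (hint : Integrable (fun z : EuclideanSpace ℝ (Fin d) => min (‖z‖ ^ 2) 1 * ν ‖z‖))
    {α : ℝ} (hα : α ∈ Set.Ioo (0 : ℝ) 2)
    (hA2 : ∀ lam : ℝ, 0 < lam →
      Tendsto (fun r : ℝ => ν (lam * r) / ν r) atTop (nhds (lam ^ (-(d : ℝ) - α))))
    {ε : ℝ} (hε : 0 < ε) :
    ∀ᶠ R : ℝ in atTop, ∀ ξ : EuclideanSpace ℝ (Fin d), ‖ξ‖ ≤ 1 →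
      |ψ d ν (R⁻¹ • ξ) / (R ^ d * ν R) - ‖ξ‖ ^ α / Aconst d α| ≤ ε := by
  have hlim := tendsto_integral_min_sq_mul_abs_sub hd hν_pos hν_mono hint hα hA2
  filter_upwards [hlim.eventually_lt_const (half_pos hε), eventually_ge_atTop 1] with R hR hR1 ξ hξ
  have hR0 : 0 < R := by linarith
  have hνR := hν_pos R hR0
  have hcos : ∀ w : EuclideanSpace ℝ (Fin d), 0 ≤ 1 - Real.cos ⟪ξ, w⟫ := fun w =>
    sub_nonneg.2 (cos_le_one _)
  have hle : ∀ w : EuclideanSpace ℝ (Fin d), 1 - Real.cos ⟪ξ, w⟫ ≤ 2 * min (‖w‖ ^ 2) 1 :=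
    fun w => by simpa using one_sub_cos_inner_le le_rfl hξ w
  have hm1 : AEStronglyMeasurable
      (fun w : EuclideanSpace ℝ (Fin d) => ν (R * ‖w‖) / ν R) := by
    simpa only [div_eq_mul_inv] using
      (aestronglyMeasurable_antitone_comp_norm hd hν_mono hR0).mul_const (ν R)⁻¹
  have hi2 : Integrable fun w : EuclideanSpace ℝ (Fin d) =>
      min (‖w‖ ^ 2) 1 * ‖w‖ ^ (-(d : ℝ) - α) := by
    rw [← neg_add']
    exact integrable_min_sq_mul_norm_rpow hd (by linarith [hα.1]) (by linarith [hα.2])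
  have hi1 : Integrable fun w : EuclideanSpace ℝ (Fin d) =>
      min (‖w‖ ^ 2) 1 * (ν (R * ‖w‖) / ν R) := by
    refine ((hint.comp_smul hR0.ne').div_const (ν R)).mono'
      ((Measurable.aestronglyMeasurable (by fun_prop)).mul hm1) ?_
    filter_upwards [ae_norm_pos hd] with w hw
    have hνw := hν_pos (R * ‖w‖) (by positivity)
    have h0 : 0 ≤ min (‖w‖ ^ 2) 1 := le_min (by positivity) zero_le_one
    rw [norm_of_nonneg (by positivity), norm_smul, norm_of_nonneg hR0.le, mul_div_assoc]
    gcongr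
    exact le_mul_of_one_le_left hw.le hR1
  have hj : ∀ f : EuclideanSpace ℝ (Fin d) → ℝ, AEStronglyMeasurable f →
      Integrable (fun w => min (‖w‖ ^ 2) 1 * f w) →
      Integrable fun w => (1 - Real.cos ⟪ξ, w⟫) * f w := by
    intro f hf hi
    refine (hi.const_mul 2).mono ((Measurable.aestronglyMeasurable (by fun_prop)).mul hf)
      (Eventually.of_forall fun w => ?_)
    have h0 : 0 ≤ min (‖w‖ ^ 2) 1 := le_min (by positivity) zero_le_one
    rw [norm_mul, ← mul_assoc, norm_mul, norm_of_nonneg (hcos w),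
      norm_of_nonneg (show 0 ≤ 2 * min (‖w‖ ^ 2) 1 by positivity)]
    gcongr
    exact hle w
  have hj1 := hj _ hm1 hi1
  have hj2 := hj _ (Measurable.aestronglyMeasurable (by fun_prop)) hi2
  have hψ : ψ d ν (R⁻¹ • ξ) / (R ^ d * ν R) =
      ∫ w : EuclideanSpace ℝ (Fin d), (1 - Real.cos ⟪ξ, w⟫) * (ν (R * ‖w‖) / ν R) := by
    simp only [← mul_div_assoc]
    rw [ψ_inv_smul ν hR0, mul_div_mul_left _ _ (by positivity), integral_div]
  rw [hψ, ← integral_one_sub_cos_mul_norm_rpow hd hα ξ, ← integral_sub hj1 hj2]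
  have hi3 : Integrable fun w : EuclideanSpace ℝ (Fin d) =>
      min (‖w‖ ^ 2) 1 * |ν (R * ‖w‖) / ν R - ‖w‖ ^ (-(d : ℝ) - α)| := by
    refine (hi1.sub hi2).abs.congr (Eventually.of_forall fun w => ?_)
    have h0 : 0 ≤ min (‖w‖ ^ 2) 1 := le_min (by positivity) zero_le_one
    simp only [Pi.sub_apply]
    rw [← mul_sub, abs_mul, abs_of_nonneg h0]
  calc |∫ w : EuclideanSpace ℝ (Fin d), ((1 - Real.cos ⟪ξ, w⟫) * (ν (R * ‖w‖) / ν R) -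
        (1 - Real.cos ⟪ξ, w⟫) * ‖w‖ ^ (-(d : ℝ) - α))|
      ≤ ∫ w : EuclideanSpace ℝ (Fin d), 2 *
        (min (‖w‖ ^ 2) 1 * |ν (R * ‖w‖) / ν R - ‖w‖ ^ (-(d : ℝ) - α)|) := by
        rw [← norm_eq_abs]
        refine norm_integral_le_of_norm_le (hi3.const_mul 2) (Eventually.of_forall fun w => ?_)
        rw [← mul_sub, norm_mul, norm_of_nonneg (hcos w), norm_eq_abs, ← mul_assoc]
        gcongr
        exact hle w
    _ ≤ ε := by rw [integral_const_mul]; linarith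

lemma setOf_ψ_eq_image_closedBall (d : ℕ) (ν : ℝ → ℝ) (r : ℝ) :
    {y : ℝ | ∃ z : EuclideanSpace ℝ (Fin d), ‖z‖ ≤ r ∧ ψ d ν z = y} =
      ψ d ν '' Metric.closedBall 0 r := by
  ext y; simp

lemma bddAbove_ψ_ball {d : ℕ} {ν : ℝ → ℝ} (hψ : Continuous (ψ d ν)) (r : ℝ) :
    BddAbove {y : ℝ | ∃ z : EuclideanSpace ℝ (Fin d), ‖z‖ ≤ r ∧ ψ d ν z = y} := by
  rw [setOf_ψ_eq_image_closedBall]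
  exact (isCompact_closedBall _ _).bddAbove_image hψ.continuousOn

lemma ψ_le_ψstar {d : ℕ} {ν : ℝ → ℝ} (hψ : Continuous (ψ d ν)) {r : ℝ}
    {z : EuclideanSpace ℝ (Fin d)} (hz : ‖z‖ ≤ r) : ψ d ν z ≤ ψstar d ν r :=
  le_csSup (bddAbove_ψ_ball hψ r) ⟨z, hz, rfl⟩

lemma ψstar_le_ψstar {d : ℕ} {ν : ℝ → ℝ} (hψ : Continuous (ψ d ν)) {a b : ℝ} (ha : 0 ≤ a)
    (hab : a ≤ b) : ψstar d ν a ≤ ψstar d ν b :=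
  csSup_le_csSup (bddAbove_ψ_ball hψ b) ⟨_, 0, by simpa using ha, rfl⟩
    fun _ ⟨z, hz, h⟩ => ⟨z, hz.trans hab, h⟩

lemma ψstar_zero (d : ℕ) (ν : ℝ → ℝ) : ψstar d ν 0 = 0 := by
  have : {y : ℝ | ∃ z : EuclideanSpace ℝ (Fin d), ‖z‖ ≤ 0 ∧ ψ d ν z = y} = {0} := by
    ext y
    simp [ψ, eq_comm]
  rw [ψstar, this, csSup_singleton]

open scoped Pointwise in
lemma continuousOn_ψstar {d : ℕ} {ν : ℝ → ℝ} (hψ : Continuous (ψ d ν)) :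
    ContinuousOn (ψstar d ν) (Set.Ici 0) := by
  have h : Continuous fun r : ℝ => sSup ((fun ξ : EuclideanSpace ℝ (Fin d) => ψ d ν (r • ξ)) ''
      Metric.closedBall 0 1) :=
    (isCompact_closedBall _ _).continuous_sSup (by
      simp only [Function.HasUncurry.uncurry, id]
      exact hψ.comp (by fun_prop))
  refine h.continuousOn.congr fun r hr => ?_
  have hr : 0 ≤ r := hr
  have hset : Metric.closedBall (0 : EuclideanSpace ℝ (Fin d)) r =
      r • Metric.closedBall (0 : EuclideanSpace ℝ (Fin d)) 1 := by
    simp [smul_unitClosedBall, norm_of_nonneg hr]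
  rw [ψstar, setOf_ψ_eq_image_closedBall, hset, ← Set.image_smul, Set.image_image]

lemma tendsto_ψstar_inv_div {d : ℕ} (hd : 1 ≤ d) {ν : ℝ → ℝ}
    (hν_pos : ∀ r : ℝ, 0 < r → 0 < ν r)
    (hν_mono : ∀ r₁ r₂ : ℝ, 0 < r₁ → r₁ ≤ r₂ → ν r₂ ≤ ν r₁)
    (hint : Integrable (fun z : EuclideanSpace ℝ (Fin d) => min (‖z‖ ^ 2) 1 * ν ‖z‖))
    {α : ℝ} (hα : α ∈ Set.Ioo (0 : ℝ) 2)
    (hA2 : ∀ lam : ℝ, 0 < lam →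
      Tendsto (fun r : ℝ => ν (lam * r) / ν r) atTop (nhds (lam ^ (-(d : ℝ) - α)))) :
    Tendsto (fun R : ℝ => ψstar d ν R⁻¹ / (R ^ d * ν R)) atTop (nhds (Aconst d α)⁻¹) := by
  have : Nonempty (Fin d) := ⟨⟨0, hd⟩⟩
  have hψ := continuous_ψ hd hν_pos hν_mono hint
  have hA : 0 < Aconst d α := Aconst_pos hα
  obtain ⟨e, he⟩ := exists_norm_eq (EuclideanSpace ℝ (Fin d)) zero_le_one
  rw [Metric.tendsto_nhds]
  intro ε hε
  filter_upwards [eventually_abs_ψ_inv_smul_div_sub_le hd hν_pos hν_mono hint hα hA2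
    (half_pos hε), eventually_gt_atTop 0] with R hR hR0
  have hg : 0 < R ^ d * ν R := mul_pos (by positivity) (hν_pos R hR0)
  have hlow : (Aconst d α)⁻¹ - ε / 2 ≤ ψstar d ν R⁻¹ / (R ^ d * ν R) := by
    have h1 := (abs_le.1 (hR e he.le)).1
    rw [he, one_rpow, one_div] at h1
    have h2 : ψ d ν (R⁻¹ • e) ≤ ψstar d ν R⁻¹ :=
      ψ_le_ψstar hψ (by rw [norm_smul, he, mul_one, norm_of_nonneg (by positivity)])
    have h3 : ψ d ν (R⁻¹ • e) / (R ^ d * ν R) ≤ ψstar d ν R⁻¹ / (R ^ d * ν R) := by gcongr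
    linarith
  have hup : ψstar d ν R⁻¹ / (R ^ d * ν R) ≤ (Aconst d α)⁻¹ + ε / 2 := by
    rw [div_le_iff₀ hg]
    refine csSup_le ⟨_, 0, by simpa using hR0.le, rfl⟩ ?_
    rintro _ ⟨z, hz, rfl⟩
    have hz1 : ‖R • z‖ ≤ 1 := by
      rw [norm_smul, norm_of_nonneg hR0.le]
      calc R * ‖z‖ ≤ R * R⁻¹ := by gcongr
        _ = 1 := mul_inv_cancel₀ hR0.ne'
    have h1 := (abs_le.1 (hR (R • z) hz1)).2
    rw [inv_smul_smul₀ hR0.ne'] at h1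
    rw [← div_le_iff₀ hg]
    have h2 : ‖R • z‖ ^ α / Aconst d α ≤ (Aconst d α)⁻¹ := by
      rw [← one_div]
      gcongr
      exact rpow_le_one (norm_nonneg _) hz1 hα.1.le
    linarith
  rw [dist_eq_norm, norm_eq_abs, abs_lt]
  constructor <;> linarith

lemma ψinv_mem {d : ℕ} {ν : ℝ → ℝ} (hψ : Continuous (ψ d ν)) (h1 : 1 ≤ ψstar d ν 1) {u : ℝ}
    (hu0 : 0 ≤ u) (hu1 : u < 1) : 0 ≤ ψinv d ν u ∧ ψstar d ν (ψinv d ν u) = u := by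
  have hcont := continuousOn_ψstar hψ
  obtain ⟨r, hr, hru⟩ := intermediate_value_Icc zero_le_one
    (hcont.mono Set.Icc_subset_Ici_self)
    (show u ∈ Set.Icc (ψstar d ν 0) (ψstar d ν 1) by
      rw [ψstar_zero]; exact ⟨hu0, hu1.le.trans h1⟩)
  have hclosed : IsClosed {r : ℝ | 0 ≤ r ∧ ψstar d ν r = u} :=
    hcont.preimage_isClosed_of_isClosed isClosed_Ici (isClosed_singleton (x := u))
  refine hclosed.csSup_mem ⟨r, hr.1, hru⟩ ⟨1, ?_⟩
  rintro t ⟨_, ht⟩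
  by_contra! h
  have := ψstar_le_ψstar hψ zero_le_one h.le
  linarith

theorem statement7
    (d : ℕ) (hd : 1 ≤ d) (ν : ℝ → ℝ)
    (hν_pos : ∀ r : ℝ, 0 < r → 0 < ν r)
    (hν_mono : ∀ r₁ r₂ : ℝ, 0 < r₁ → r₁ ≤ r₂ → ν r₂ ≤ ν r₁)
    (hint : Integrable (fun z : EuclideanSpace ℝ (Fin d) => min (‖z‖ ^ 2) 1 * ν ‖z‖))
    (hninf : ¬ Integrable (fun z : EuclideanSpace ℝ (Fin d) => ν ‖z‖))
    (α : ℝ) (hα : α ∈ Set.Ioo (0:ℝ) 2)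
    (hA2 : ∀ lam : ℝ, 0 < lam →
      Tendsto (fun r : ℝ => ν (lam * r) / ν r) atTop (nhds (lam ^ (-(d:ℝ) - α))))
    (hnorm : ∀ ξ : EuclideanSpace ℝ (Fin d), ‖ξ‖ = 1 → ψ d ν ξ = 1)
:
    ∀ x : EuclideanSpace ℝ (Fin d), x ≠ 0 →
      Tendsto (fun s : ℝ => νs d ν s x) atTop
        (nhds (Aconst d α * ‖x‖ ^ (-(d:ℝ) - α))) := by
  intro x hx
  have : Nonempty (Fin d) := ⟨⟨0, hd⟩⟩
  have hx0 : 0 < ‖x‖ := norm_pos_iff.2 hx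
  have hψ := continuous_ψ hd hν_pos hν_mono hint
  have hA : 0 < Aconst d α := Aconst_pos hα
  have hstar := tendsto_ψstar_inv_div hd hν_pos hν_mono hint hα hA2
  obtain ⟨e, he⟩ := exists_norm_eq (EuclideanSpace ℝ (Fin d)) zero_le_one
  have h1 : 1 ≤ ψstar d ν 1 := (hnorm e he).symm.le.trans (ψ_le_ψstar hψ he.le)
  have hinv : ∀ᶠ s : ℝ in atTop, 0 < ψinv d ν (1 / s) ∧
      ψstar d ν (ψinv d ν (1 / s)) = 1 / s := by
    filter_upwards [eventually_gt_atTop 1] with s hs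
    have hs0 : 0 < s := by linarith
    obtain ⟨h0, h⟩ := ψinv_mem hψ h1 (one_div_pos.2 hs0).le ((div_lt_one hs0).2 hs)
    refine ⟨h0.lt_of_ne fun h' => ?_, h⟩
    rw [← h', ψstar_zero] at h
    exact (one_div_pos.2 hs0).ne h
  have hR : Tendsto (fun s : ℝ => (ψinv d ν (1 / s))⁻¹) atTop atTop := by
    rw [tendsto_atTop]
    intro b
    obtain ⟨R, hRpos, hRb, hR0⟩ := ((hstar.eventually_const_lt (inv_pos.2 hA)).and
      ((eventually_ge_atTop b).and (eventually_gt_atTop 0))).exists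
    have hg : 0 < R ^ d * ν R := mul_pos (by positivity) (hν_pos R hR0)
    have hpos : 0 < ψstar d ν R⁻¹ := (div_pos_iff_of_pos_right hg).1 hRpos
    filter_upwards [hinv, eventually_gt_atTop (1 / ψstar d ν R⁻¹), eventually_gt_atTop 0]
      with s hs hs1 hs0
    refine hRb.trans ?_
    rw [le_inv_comm₀ hR0 hs.1]
    by_contra! h
    have h2 := ψstar_le_ψstar hψ (by positivity) h.le
    rw [hs.2] at h2
    have h3 := (one_div_lt hpos hs0).1 hs1
    linarith
  have hlim := (hstar.comp hR).inv₀ (inv_ne_zero hA.ne')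
  rw [inv_inv] at hlim
  refine (hlim.mul ((hA2 ‖x‖ hx0).comp hR)).congr' ?_
  filter_upwards [hinv, eventually_gt_atTop 0] with s hs hs0
  have hr := hs.1
  have hν := hν_pos (ψinv d ν (1 / s))⁻¹ (inv_pos.2 hr)
  simp only [Function.comp_apply, inv_inv, νs]
  rw [hs.2, ← div_eq_mul_inv ‖x‖, inv_pow]
  generalize ν (ψinv d ν (1 / s))⁻¹ = y at *
  generalize ν (‖x‖ / ψinv d ν (1 / s)) = z
  generalize ψinv d ν (1 / s) = r at *
  field_simp

end
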